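/- Let n be a positive integer with 4 dividing n(n+1)/2, and let p_1 ≤ p_2 ≤ p_3 ≤ p_4 be positive integers with p_1+p_2+p_3+p_4 = n satisfying condition (★) with k = 4. If there is no equitable partition of [n] implementing (p_1,p_2,p_3,p_4), then every minimal partition implementing (p_1,p_2,p_3,p_4) has exactly one low set, whose sum is s^{n,4} − 1, exactly one high set, whose sum is s^{n,4} + 1, and exactly two exact sets. -/

import Mathlib

open Finset

/-- `s^{n,k} = (n(n+1)/2)/k`. -/
def magicConst (n k : ℕ) : ℕ := (n * (n + 1) / 2) / k

/-- `A` is a partition of `[n] = {1,…,n}` into `k` (indexed) parts. -/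
def IsPartitionOn (n : ℕ) {k : ℕ} (A : Fin k → Finset ℕ) : Prop :=
  (∀ i j : Fin k, i ≠ j → Disjoint (A i) (A j)) ∧
    Finset.univ.biUnion A = Finset.Icc 1 n

/-- The partition `A` of `[n]` implements the sequence of sizes `p` (up to reindexing). -/
def Implements (n : ℕ) {k : ℕ} (A : Fin k → Finset ℕ) (p : Fin k → ℕ) : Prop :=
  IsPartitionOn n A ∧ ∃ e : Equiv.Perm (Fin k), ∀ i, (A (e i)).card = p i

/-- Every part of the partition has sum `s^{n,k}`. -/
def Equitable (n : ℕ) {k : ℕ} (A : Fin k → Finset ℕ) : Prop :=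
  ∀ i, (A i).sum id = magicConst n k

/-- `d(A) = Σ_i (S(A_i) − s^{n,k})²`. -/
def dVal (n : ℕ) {k : ℕ} (A : Fin k → Finset ℕ) : ℤ :=
  ∑ i : Fin k, ((((A i).sum id : ℕ) : ℤ) - (magicConst n k : ℤ)) ^ 2

/-- A partition implementing `p` minimizing `d` among all partitions implementing `p`. -/
def MinimalPartition (n : ℕ) {k : ℕ} (A : Fin k → Finset ℕ) (p : Fin k → ℕ) : Prop :=
  Implements n A p ∧ ∀ B : Fin k → Finset ℕ, Implements n B p → dVal n A ≤ dVal n B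

/-- Condition (★): `Σ_{i=1}^{P_j} (n−i+1) ≥ j·s^{n,k}` for all `j = 1,…,k`,
where `P_j = p_1 + ⋯ + p_j`. -/
def StarCond (n k : ℕ) (p : Fin k → ℕ) : Prop :=
  ∀ j : Fin k,
    ((j : ℕ) + 1) * magicConst n k ≤ ∑ i ∈ Finset.range (∑ t ∈ Finset.Iic j, p t), (n - i)

/-- The width `ω(A)` of a partition: the minimum of `y − x` over pairs `x < y` with `x`
in a low set and `y` in a high set (`⊤` if there is no such pair). -/
noncomputable def width (n : ℕ) {k : ℕ} (A : Fin k → Finset ℕ) : ℕ∞ :=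
  sInf { w : ℕ∞ | ∃ (x y : ℕ) (i j : Fin k), x ∈ A i ∧ y ∈ A j ∧ x < y ∧
    (A i).sum id < magicConst n k ∧ magicConst n k < (A j).sum id ∧ w = (y - x : ℕ) }

/-- Among the index sets with `j + 1` elements, the initial segment has the least sum of a
monotone sequence. -/
lemma sum_Iic_le_sum_of_monotone {k : ℕ} {p : Fin k → ℕ} (hp : Monotone p) (j : Fin k)
    (K : Finset (Fin k)) (hK : #K = j + 1) : ∑ t ∈ Iic j, p t ≤ ∑ t ∈ K, p t := by
  have hcard : #(Iic j \ K) = #(K \ Iic j) :=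
    card_sdiff_comm (by rw [hK, Fin.card_Iic])
  have h1 : ∑ t ∈ Iic j \ K, p t ≤ #(Iic j \ K) • p j :=
    sum_le_card_nsmul _ _ _ fun t ht => hp (mem_Iic.1 (mem_sdiff.1 ht).1)
  have h2 : #(K \ Iic j) • p j ≤ ∑ t ∈ K \ Iic j, p t :=
    card_nsmul_le_sum _ _ _ fun t ht =>
      hp (le_of_lt (not_le.1 fun h => (mem_sdiff.1 ht).2 (mem_Iic.2 h)))
  rw [hcard] at h1
  rw [← sum_inter_add_sum_sdiff (Iic j) K p, ← sum_inter_add_sum_sdiff K (Iic j) p,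
    inter_comm K]
  exact Nat.add_le_add_left (h1.trans h2) _

/-- A subset of `[n]` that is closed upwards consists of the largest elements of `[n]`. -/
lemma sum_range_sub_le_sum_of_succ_mem {n m : ℕ} {U : Finset ℕ} (hU : U ⊆ Icc 1 n)
    (hup : ∀ x ∈ U, x + 1 ≤ n → x + 1 ∈ U) (hm : m ≤ #U) :
    ∑ i ∈ range m, (n - i) ≤ U.sum id := by
  have hcard : #U ≤ n := by simpa using card_le_card hU
  have hup' : ∀ x ∈ U, ∀ y, x ≤ y → y ≤ n → y ∈ U := by
    intro x hx y hxy
    induction y, hxy using Nat.le_induction with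
    | base => exact fun _ => hx
    | succ y _ ih => exact fun hy => hup y (ih (by omega)) hy
  have hmem : ∀ i < m, n - i ∈ U := by
    intro i hi
    by_contra hni
    have hsub : U ⊆ Ioc (n - i) n := by
      intro x hx
      have hxn := (mem_Icc.1 (hU hx)).2
      refine mem_Ioc.2 ⟨not_le.1 fun hle => hni (hup' x hx _ hle (Nat.sub_le _ _)), hxn⟩
    have := card_le_card hsub
    rw [Nat.card_Ioc] at this
    omega
  have hinj : Set.InjOn (fun i => n - i) (range m : Set ℕ) := by
    intro a ha b hb hab
    simp only [coe_range, Set.mem_Iio] at ha hb hab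
    omega
  calc ∑ i ∈ range m, (n - i) = ((range m).image fun i => n - i).sum id := by
        rw [sum_image hinj]; rfl
    _ ≤ U.sum id := by
        refine sum_le_sum_of_subset fun y hy => ?_
        obtain ⟨i, hi, rfl⟩ := mem_image.1 hy
        exact hmem i (mem_range.1 hi)

/-- Under condition (★), if the parts indexed by `J` have total sum less than `#J` times the
magic constant, then some element of them is followed by an element of another part. -/
lemma exists_succ_mem_of_sum_lt {n k : ℕ} {p : Fin k → ℕ} (hmono : Monotone p)
    (hstar : StarCond n k p) {A : Fin k → Finset ℕ} (hA : Implements n A p)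
    {J : Finset (Fin k)} (hJ : ∑ t ∈ J, (A t).sum id < #J * magicConst n k) :
    ∃ i ∈ J, ∃ j ∉ J, ∃ x ∈ A i, x + 1 ∈ A j := by
  obtain ⟨⟨hdisj, hunion⟩, e, he⟩ := hA
  have hpair : (J : Set (Fin k)).PairwiseDisjoint A := fun i _ j _ hij => hdisj i j hij
  by_contra! hcon
  have hU : J.biUnion A ⊆ Icc 1 n := by
    rw [← hunion]
    exact biUnion_subset_biUnion_of_subset_left A (subset_univ J)
  have hup : ∀ x ∈ J.biUnion A, x + 1 ≤ n → x + 1 ∈ J.biUnion A := by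
    intro x hx hxn
    obtain ⟨i, hi, hxi⟩ := mem_biUnion.1 hx
    have hmem : x + 1 ∈ univ.biUnion A := by
      rw [hunion]; exact mem_Icc.2 ⟨by omega, hxn⟩
    obtain ⟨j, -, hj⟩ := mem_biUnion.1 hmem
    by_cases hjJ : j ∈ J
    · exact mem_biUnion.2 ⟨j, hjJ, hj⟩
    · exact absurd hj (hcon i hi j hjJ x hxi)
  have hpos : 0 < #J := by
    rcases Nat.eq_zero_or_pos #J with h | h
    · simp [h] at hJ
    · exact h
  have hle : #J ≤ k := by simpa using card_le_univ J
  let j : Fin k := ⟨#J - 1, by omega⟩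
  have hj : (j : ℕ) + 1 = #J := Nat.sub_add_cancel hpos
  have hcard : ∑ t ∈ Iic j, p t ≤ #(J.biUnion A) := by
    calc ∑ t ∈ Iic j, p t ≤ ∑ t ∈ J.map e.symm.toEmbedding, p t :=
          sum_Iic_le_sum_of_monotone hmono j _ (by rw [card_map, hj])
      _ = ∑ t ∈ J, #(A t) := by
          rw [sum_map]
          exact sum_congr rfl fun t _ => by simp [← he]
      _ = #(J.biUnion A) := (card_biUnion hpair).symm
  have h1 := hstar j
  have h2 := sum_range_sub_le_sum_of_succ_mem hU hup hcard
  rw [hj] at h1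
  rw [sum_biUnion hpair] at h2
  exact absurd hJ (not_lt.2 (h1.trans h2))

lemma add_sum_swap {s : Finset ℕ} {a b : ℕ} (ha : a ∈ s) (hb : b ∉ s) :
    a + ∑ y ∈ s, Equiv.swap a b y = b + ∑ y ∈ s, y := by
  have h : ∑ y ∈ s.erase a, Equiv.swap a b y = ∑ y ∈ s.erase a, y :=
    sum_congr rfl fun y hy =>
      Equiv.swap_apply_of_ne_of_ne (ne_of_mem_erase hy)
        fun hyb => hb (hyb ▸ mem_of_mem_erase hy)
  rw [← add_sum_erase s _ ha, ← add_sum_erase s _ ha, h, Equiv.swap_apply_left]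
  ring

/-- Permuting the elements of `[n]` preserves implementing a given sequence of sizes. -/
lemma Implements.map {n k : ℕ} {A : Fin k → Finset ℕ} {p : Fin k → ℕ} (hA : Implements n A p)
    (σ : Equiv.Perm ℕ) (hσ : (Icc 1 n).map σ.toEmbedding = Icc 1 n) :
    Implements n (fun t => (A t).map σ.toEmbedding) p := by
  obtain ⟨⟨hdisj, hunion⟩, e, he⟩ := hA
  refine ⟨⟨fun i j hij => (disjoint_map _).2 (hdisj i j hij), ?_⟩, e, fun i => ?_⟩
  · conv_rhs => rw [← hσ, ← hunion]
    ext y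
    simp only [mem_biUnion, mem_map, mem_univ, true_and]
    constructor
    · rintro ⟨t, a, ha, rfl⟩
      exact ⟨a, ⟨t, ha⟩, rfl⟩
    · rintro ⟨a, ⟨t, ha⟩, rfl⟩
      exact ⟨t, a, ha, rfl⟩
  · rw [card_map, he]

/-- In a minimal partition, a part containing the successor of an element of another part
exceeds the sum of that part by at most one. -/
lemma MinimalPartition.sum_le_sum_add_one {n k : ℕ} {A : Fin k → Finset ℕ} {p : Fin k → ℕ}
    (hA : MinimalPartition n A p) {i j : Fin k} (hij : i ≠ j) {x : ℕ} (hx : x ∈ A i)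
    (hx' : x + 1 ∈ A j) : (A j).sum id ≤ (A i).sum id + 1 := by
  obtain ⟨himp, hmin⟩ := hA
  have hdisj := himp.1.1
  have hunion := himp.1.2
  have hmem : ∀ t, ∀ y ∈ A t, y ∈ Icc 1 n := fun t y hy => by
    rw [← hunion]; exact mem_biUnion.2 ⟨t, mem_univ t, hy⟩
  have hσ : (Icc 1 n).map (Equiv.swap x (x + 1)).toEmbedding = Icc 1 n := by
    refine eq_of_subset_of_card_le (fun y hy => ?_) (by rw [card_map])
    obtain ⟨a, ha, rfl⟩ := mem_map.1 hy
    rw [Equiv.coe_toEmbedding, Equiv.swap_apply_def]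
    split_ifs
    exacts [hmem j _ hx', hmem i _ hx, ha]
  have hd := hmin _ (himp.map _ hσ)
  have hi : (∑ y ∈ A i, Equiv.swap x (x + 1) y) = (∑ y ∈ A i, y) + 1 := by
    have := add_sum_swap hx fun h => disjoint_left.1 (hdisj i j hij) h hx'
    omega
  have hj : (∑ y ∈ A j, Equiv.swap x (x + 1) y) + 1 = ∑ y ∈ A j, y := by
    have := add_sum_swap hx' fun h => disjoint_left.1 (hdisj i j hij) hx h
    rw [Equiv.swap_comm] at this
    omega
  have ho : ∀ t, t ≠ i → t ≠ j → (∑ y ∈ A t, Equiv.swap x (x + 1) y) = ∑ y ∈ A t, y := by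
    intro t hti htj
    refine sum_congr rfl fun y hy => Equiv.swap_apply_of_ne_of_ne ?_ ?_
    · rintro rfl
      exact disjoint_left.1 (hdisj t i hti) hy hx
    · rintro rfl
      exact disjoint_left.1 (hdisj t j htj) hy hx'
  simp only [dVal, sum_map, id, Equiv.coe_toEmbedding] at hd ⊢
  rw [← sub_nonneg, ← sum_sub_distrib, sum_eq_add i j hij
    (fun t _ ht => by rw [ho t ht.1 ht.2, sub_self]) (by simp) (by simp), hi, ← hj] at hd
  rw [← hj]
  push_cast at hd
  zify
  linarith

/-- Lemma 4. -/
theorem stmt_11 (n : ℕ) (hn : 0 < n) (hdvd : 4 ∣ n * (n + 1) / 2)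
    (p : Fin 4 → ℕ) (hp : ∀ i, 0 < p i) (hmono : Monotone p)
    (hsum : ∑ i : Fin 4, p i = n) (hstar : StarCond n 4 p)
    (hne : ¬ ∃ B : Fin 4 → Finset ℕ, Implements n B p ∧ Equitable n B) :
    ∀ A : Fin 4 → Finset ℕ, MinimalPartition n A p →
      ∃ i j : Fin 4, i ≠ j ∧
        (A i).sum id + 1 = magicConst n 4 ∧
        (A j).sum id = magicConst n 4 + 1 ∧
        (∀ t : Fin 4, t ≠ i → t ≠ j → (A t).sum id = magicConst n 4) := by
  intro A hA
  set s := magicConst n 4 with hs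
  have htotal : ∑ t, (A t).sum id = 4 * s := by
    rw [← sum_biUnion fun i _ j _ hij => hA.1.1.1 i j hij, hA.1.1.2, hs, magicConst,
      Nat.mul_div_cancel' hdvd]
    have h := sum_range_id (n + 1)
    rw [range_eq_Ico, sum_eq_sum_Ico_succ_bot n.succ_pos, zero_add, zero_add,
      Nat.add_sub_cancel, mul_comm] at h
    exact h
  have hlow : ∃ u, (A u).sum id < s := by
    by_contra! hge
    refine hne ⟨A, hA.1, fun t => ?_⟩
    have heq : ∑ _t : Fin 4, s = ∑ t, (A t).sum id := by rw [htotal]; simp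
    exact ((sum_eq_sum_iff_of_le fun t _ => hge t).1 heq t (mem_univ t)).symm
  obtain ⟨u, hu⟩ := hlow
  have hstep : ∀ J : Finset (Fin 4), u ∈ J → (∀ t ∈ J, (A t).sum id ≤ s) →
      ∃ i ∈ J, ∃ j ∉ J, (A j).sum id ≤ (A i).sum id + 1 := by
    intro J huJ hJ
    have hlt : ∑ t ∈ J, (A t).sum id < #J * s := by
      calc ∑ t ∈ J, (A t).sum id < ∑ _t ∈ J, s := sum_lt_sum hJ ⟨u, huJ, hu⟩
        _ = #J * s := by rw [sum_const, smul_eq_mul]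
    obtain ⟨i, hi, j, hj, x, hx, hx'⟩ := exists_succ_mem_of_sum_lt hmono hstar hA.1 hlt
    exact ⟨i, hi, j, hj, hA.sum_le_sum_add_one (fun h => hj (h ▸ hi)) hx hx'⟩
  obtain ⟨i, hi, v, hv, hiv⟩ := hstep {t | (A t).sum id < s} (by simpa using hu)
    fun t ht => (mem_filter.1 ht).2.le
  obtain ⟨w, hw, j, hj, hwj⟩ := hstep {t | (A t).sum id ≤ s} (by simpa using hu.le)
    fun t ht => (mem_filter.1 ht).2
  simp only [mem_filter, mem_univ, true_and, not_lt, not_le] at hi hv hw hj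
  have hij : i ≠ j := by rintro rfl; omega
  have hvi : v ≠ i := by rintro rfl; omega
  have hvj : v ≠ j := by rintro rfl; omega
  refine ⟨i, j, hij, by omega, by omega, fun t hti htj => ?_⟩
  rcases eq_or_ne t v with rfl | htv
  · omega
  have huniv : ({i, j, v, t} : Finset (Fin 4)) = univ := by
    refine eq_univ_of_card _ ?_
    rw [card_insert_of_notMem (by simp [hij, hvi.symm, hti.symm]),
      card_insert_of_notMem (by simp [hvj.symm, htj.symm]), card_pair htv.symm, Fintype.card_fin]
  rw [← huniv, sum_insert (by simp [hij, hvi.symm, hti.symm]),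
    sum_insert (by simp [hvj.symm, htj.symm]), sum_pair htv.symm] at htotal
  omega
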